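/- Let F = ℝ(x,y,z) be the field of fractions of ℝ[x,y,z], let τ : F ≃ F be the field automorphism induced by the cyclic permutation x ↦ y ↦ z ↦ x of the variables, and let L = ℝ(x², y², z², x·y·z) ⊆ F. Let X ∈ M₃(F) be the matrix with entries X₀₂ = z, X₁₀ = x, X₂₁ = y and all other entries 0, and for l ∈ F let D(l) = diag(l, τ(l), τ²(l)). Then the matrix Y = Xᵀ·X²·Xᵀ, which equals the diagonal matrix diag(x²z², x²y², y²z²), can NOT be written as a finite sum Y = Σₖ Zₖ · Zₖᵀ where each Zₖ = D(aₖ) + D(bₖ)·X + D(cₖ)·Xᵀ with aₖ, bₖ, cₖ ∈ L. -/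

import Mathlib

open MvPolynomial Matrix

/-- `F = ℝ(x,y,z)`, the field of fractions of `ℝ[x,y,z]`. -/
noncomputable abbrev F3 : Type := FractionRing (MvPolynomial (Fin 3) ℝ)

/-- The image of the variable `x` in `F = ℝ(x,y,z)`. -/
noncomputable def F3x : F3 := algebraMap (MvPolynomial (Fin 3) ℝ) F3 (X 0)

/-- The image of the variable `y` in `F = ℝ(x,y,z)`. -/
noncomputable def F3y : F3 := algebraMap (MvPolynomial (Fin 3) ℝ) F3 (X 1)

/-- The image of the variable `z` in `F = ℝ(x,y,z)`. -/
noncomputable def F3z : F3 := algebraMap (MvPolynomial (Fin 3) ℝ) F3 (X 2)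

/-- The field automorphism `τ` of `F = ℝ(x,y,z)` induced by the cyclic permutation of the
variables `x ↦ y, y ↦ z, z ↦ x`, i.e. the unique extension to `F` of the ring automorphism
of `ℝ[x,y,z]` renaming the variables along the cycle `(x y z)` (namely `rename (finRotate 3)`,
which sends `X i` to `X (i+1)`). -/
noncomputable def τ : F3 ≃ₐ[ℝ] F3 :=
  IsFractionRing.algEquivOfAlgEquiv (MvPolynomial.renameEquiv ℝ (finRotate 3))

/-- `L = ℝ(x², y², z², xyz)` as an intermediate field of `F/ℝ`. -/
noncomputable def L : IntermediateField ℝ F3 :=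
  IntermediateField.adjoin ℝ {F3x ^ 2, F3y ^ 2, F3z ^ 2, F3x * F3y * F3z}

/-- The matrix `X` with entries `X₀₂ = z`, `X₁₀ = x`, `X₂₁ = y` and all other entries `0`. -/
noncomputable def Xmat : Matrix (Fin 3) (Fin 3) F3 :=
  !![0, 0, F3z; F3x, 0, 0; 0, F3y, 0]

/-- For `l ∈ F`, the diagonal matrix `D(l) = diag(l, τ(l), τ²(l))`. -/
noncomputable def D (l : F3) : Matrix (Fin 3) (Fin 3) F3 :=
  Matrix.diagonal ![l, τ l, τ (τ l)]

/-- All exponent vectors in the support have three entries of the same parity. -/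
def EqPar (q : MvPolynomial (Fin 3) ℝ) : Prop :=
  ∀ d ∈ q.support, d 0 % 2 = d 1 % 2 ∧ d 1 % 2 = d 2 % 2

lemma EqPar.add {p q : MvPolynomial (Fin 3) ℝ} (hp : EqPar p) (hq : EqPar q) : EqPar (p + q) := by
  classical
  intro d hd
  rcases Finset.mem_union.1 (MvPolynomial.support_add hd) with h | h
  · exact hp d h
  · exact hq d h

lemma EqPar.mul {p q : MvPolynomial (Fin 3) ℝ} (hp : EqPar p) (hq : EqPar q) : EqPar (p * q) := by
  classical
  intro d hd
  obtain ⟨e, he, f, hf, rfl⟩ := Finset.mem_add.1 (MvPolynomial.support_mul p q hd)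
  have h1 := hp e he
  have h2 := hq f hf
  simp only [Finsupp.add_apply]
  omega

lemma EqPar.mono (d : Fin 3 →₀ ℕ) (c : ℝ) (hd : d 0 % 2 = d 1 % 2 ∧ d 1 % 2 = d 2 % 2) :
    EqPar (monomial d c) := by
  intro e he
  have := Finset.mem_singleton.1 (MvPolynomial.support_monomial_subset he)
  rwa [this]

lemma EqPar.C (c : ℝ) : EqPar (MvPolynomial.C c) :=
  EqPar.mono 0 c (by simp)

lemma EqPar.X_sq (i : Fin 3) : EqPar (X i ^ 2) := by
  rw [MvPolynomial.X_pow_eq_monomial]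
  apply EqPar.mono
  fin_cases i <;> simp

lemma EqPar.xyz : EqPar (X 0 * X 1 * X 2) := by
  have : (X 0 * X 1 * X 2 : MvPolynomial (Fin 3) ℝ) =
    monomial (Finsupp.single 0 1 + Finsupp.single 1 1 + Finsupp.single 2 1) 1 := by
    simp [MvPolynomial.X, MvPolynomial.monomial_mul]
  rw [this]
  apply EqPar.mono
  simp

/-- Positive leading coefficient and an admissible leading exponent (or zero). -/
def GoodP (p : MvPolynomial (Fin 3) ℝ) : Prop :=
  p = 0 ∨ (0 < (MonomialOrder.lex (σ := Fin 3)).leadingCoeff p ∧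
    ((MonomialOrder.lex.degree p) 0 % 4 = (MonomialOrder.lex.degree p) 1 % 4 ∨
     (MonomialOrder.lex.degree p) 1 % 4 = (MonomialOrder.lex.degree p) 2 % 4))

lemma GoodP.add {p q : MvPolynomial (Fin 3) ℝ} (hp : GoodP p) (hq : GoodP q) : GoodP (p + q) := by
  rcases hp with rfl | ⟨hp, hp'⟩
  · simpa using hq
  rcases hq with rfl | ⟨hq, hq'⟩
  · rw [add_zero]; exact Or.inr ⟨hp, hp'⟩
  right
  rcases lt_trichotomy (MonomialOrder.lex.toSyn (MonomialOrder.lex.degree p))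
    (MonomialOrder.lex.toSyn (MonomialOrder.lex.degree q)) with h | h | h
  · rw [add_comm p q, MonomialOrder.leadingCoeff_add_of_lt h, MonomialOrder.degree_add_of_lt h]
    exact ⟨hq, hq'⟩
  · have h' := MonomialOrder.lex.toSyn.injective h
    have hc : 0 < (p + q).coeff (MonomialOrder.lex.degree p) := by
      rw [coeff_add]
      have : 0 < q.coeff (MonomialOrder.lex.degree p) := by rw [h']; exact hq
      exact add_pos hp this
    have hd : MonomialOrder.lex.degree (p + q) = MonomialOrder.lex.degree p := by
      apply MonomialOrder.lex.toSyn.injective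
      apply le_antisymm
      · refine MonomialOrder.degree_add_le.trans ?_
        rw [h, sup_idem]
      · exact MonomialOrder.le_degree (by simpa using hc.ne')
    rw [MonomialOrder.leadingCoeff, hd]
    exact ⟨hc, hp'⟩
  · rw [MonomialOrder.leadingCoeff_add_of_lt h, MonomialOrder.degree_add_of_lt h]
    exact ⟨hp, hp'⟩

lemma degree_mul_sq {p q : MvPolynomial (Fin 3) ℝ} (hp : p ≠ 0) (hq : q ≠ 0) :
    MonomialOrder.lex.degree (p * q ^ 2) =
      MonomialOrder.lex.degree p + 2 • MonomialOrder.lex.degree q := by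
  rw [MonomialOrder.degree_mul hp (pow_ne_zero _ hq), MonomialOrder.degree_pow]

lemma GoodP.mul_sq {p q : MvPolynomial (Fin 3) ℝ} (hp : GoodP p) (hq : EqPar q) :
    GoodP (p * q ^ 2) := by
  by_cases hq0 : q = 0
  · left; simp [hq0]
  rcases hp with rfl | ⟨hp, hp'⟩
  · left; simp
  right
  have hp0 : p ≠ 0 := by rintro rfl; simp at hp
  have hc : MonomialOrder.lex.leadingCoeff q ≠ 0 := by simpa using hq0
  have h := hq _ (MonomialOrder.lex.degree_mem_support hq0)
  rw [degree_mul_sq hp0 hq0, MonomialOrder.leadingCoeff_mul, MonomialOrder.leadingCoeff_pow]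
  refine ⟨by positivity, ?_⟩
  simp only [Finsupp.add_apply, Finsupp.smul_apply, smul_eq_mul]
  omega

lemma GoodP.one : GoodP 1 := by
  right
  simp [MonomialOrder.degree_one]

lemma GoodP.X_sq (i : Fin 3) (hi : i ≠ 1) : GoodP (X i ^ 2) := by
  right
  rw [MonomialOrder.degree_pow, MonomialOrder.leadingCoeff_pow, MonomialOrder.degree_X,
    MonomialOrder.leadingCoeff_X]
  fin_cases i <;> simp at hi ⊢

lemma not_goodP {q : MvPolynomial (Fin 3) ℝ} (hq : EqPar q) (hq0 : q ≠ 0) :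
    ¬ GoodP (X 0 ^ 2 * X 2 ^ 2 * q ^ 2) := by
  have h0 : (X 0 ^ 2 * X 2 ^ 2 : MvPolynomial (Fin 3) ℝ) ≠ 0 := by simp
  rintro (h | ⟨-, h⟩)
  · exact mul_ne_zero h0 (pow_ne_zero _ hq0) h
  have h1 := hq _ (MonomialOrder.lex.degree_mem_support hq0)
  rw [degree_mul_sq h0 hq0, degree_mul_sq (by simp) (by simp), MonomialOrder.degree_pow,
    MonomialOrder.degree_X, MonomialOrder.degree_X] at h
  simp at h
  omega

/-- Extension of `GoodP` to fractions. -/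
def GoodF (f : F3) : Prop :=
  ∃ q p : MvPolynomial (Fin 3) ℝ, q ≠ 0 ∧ EqPar q ∧ GoodP p ∧
    f * (algebraMap _ F3 q) ^ 2 = algebraMap _ F3 p

lemma GoodF.zero : GoodF 0 :=
  ⟨1, 0, one_ne_zero, EqPar.C 1, Or.inl rfl, by simp⟩

lemma GoodF.add {f g : F3} (hf : GoodF f) (hg : GoodF g) : GoodF (f + g) := by
  obtain ⟨q, p, h0, h1, h2, h3⟩ := hf
  obtain ⟨q', p', h0', h1', h2', h3'⟩ := hg
  refine ⟨q * q', p * q' ^ 2 + p' * q ^ 2, mul_ne_zero h0 h0', h1.mul h1',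
    (h2.mul_sq h1').add (h2'.mul_sq h1), ?_⟩
  simp only [map_mul, map_add, map_pow, ← h3, ← h3']
  ring

lemma adjoin_rep {r : F3}
    (hr : r ∈ Algebra.adjoin ℝ {F3x ^ 2, F3y ^ 2, F3z ^ 2, F3x * F3y * F3z}) :
    ∃ p : MvPolynomial (Fin 3) ℝ, EqPar p ∧ algebraMap _ F3 p = r := by
  induction hr using Algebra.adjoin_induction with
  | mem x hx =>
    rcases hx with rfl | rfl | rfl | rfl
    · exact ⟨X 0 ^ 2, EqPar.X_sq 0, by simp [F3x]⟩
    · exact ⟨X 1 ^ 2, EqPar.X_sq 1, by simp [F3y]⟩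
    · exact ⟨X 2 ^ 2, EqPar.X_sq 2, by simp [F3z]⟩
    · exact ⟨X 0 * X 1 * X 2, EqPar.xyz, by simp [F3x, F3y, F3z]⟩
  | algebraMap c =>
    refine ⟨MvPolynomial.C c, EqPar.C c, ?_⟩
    rw [IsScalarTower.algebraMap_apply ℝ (MvPolynomial (Fin 3) ℝ) F3]
    rfl
  | add x y _ _ hx hy =>
    obtain ⟨p, hp, rfl⟩ := hx
    obtain ⟨q, hq, rfl⟩ := hy
    exact ⟨p + q, hp.add hq, map_add _ _ _⟩
  | mul x y _ _ hx hy =>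
    obtain ⟨p, hp, rfl⟩ := hx
    obtain ⟨q, hq, rfl⟩ := hy
    exact ⟨p * q, hp.mul hq, map_mul _ _ _⟩

lemma GoodF.mul_sq {g : MvPolynomial (Fin 3) ℝ} (hg : GoodP g) {a : F3} (ha : a ∈ L) :
    GoodF (algebraMap _ F3 g * a ^ 2) := by
  obtain ⟨r, hr, s, hs, rfl⟩ := IntermediateField.mem_adjoin_iff_div.1 ha
  obtain ⟨p, hp, rfl⟩ := adjoin_rep hr
  obtain ⟨q, hq, rfl⟩ := adjoin_rep hs
  by_cases hq0 : q = 0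
  · subst hq0
    simpa using GoodF.zero
  have hq1 : algebraMap _ F3 q ≠ 0 := by
    simpa using hq0
  refine ⟨q, g * p ^ 2, hq0, hq, hg.mul_sq hp, ?_⟩
  rw [map_mul, map_pow]
  field_simp

lemma not_goodF : ¬ GoodF (F3x ^ 2 * F3z ^ 2) := by
  rintro ⟨q, p, h0, h1, h2, h3⟩
  have : X 0 ^ 2 * X 2 ^ 2 * q ^ 2 = p := by
    apply IsFractionRing.injective (MvPolynomial (Fin 3) ℝ) F3
    rw [← h3]
    simp [F3x, F3z]
  exact not_goodP h1 h0 (this ▸ h2)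

theorem stmt9 :
    Xmatᵀ * Xmat ^ 2 * Xmatᵀ =
      Matrix.diagonal ![F3x ^ 2 * F3z ^ 2, F3x ^ 2 * F3y ^ 2, F3y ^ 2 * F3z ^ 2] ∧
    ¬ ∃ (m : ℕ) (a b c : Fin m → F3),
        (∀ k, a k ∈ L) ∧ (∀ k, b k ∈ L) ∧ (∀ k, c k ∈ L) ∧
        Xmatᵀ * Xmat ^ 2 * Xmatᵀ =
          ∑ k, (D (a k) + D (b k) * Xmat + D (c k) * Xmatᵀ) *
               (D (a k) + D (b k) * Xmat + D (c k) * Xmatᵀ)ᵀ := by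
  have key : Xmatᵀ * Xmat ^ 2 * Xmatᵀ =
      Matrix.diagonal ![F3x ^ 2 * F3z ^ 2, F3x ^ 2 * F3y ^ 2, F3y ^ 2 * F3z ^ 2] := by
    ext i j
    fin_cases i <;> fin_cases j <;>
      simp [Xmat, pow_two, Matrix.mul_apply, Fin.sum_univ_three, Matrix.transpose_apply] <;> ring
  refine ⟨key, ?_⟩
  rintro ⟨m, a, b, c, ha, hb, hc, h⟩
  rw [key] at h
  have h00 := congrFun (congrFun h 0) 0
  rw [Matrix.sum_apply] at h00
  apply not_goodF
  have e : F3x ^ 2 * F3z ^ 2 = ∑ k, (algebraMap (MvPolynomial (Fin 3) ℝ) F3 1 * a k ^ 2 +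
      algebraMap (MvPolynomial (Fin 3) ℝ) F3 (X 0 ^ 2) * c k ^ 2 + algebraMap (MvPolynomial (Fin 3) ℝ) F3 (X 2 ^ 2) * b k ^ 2) := by
    refine Eq.trans ?_ (h00.trans (Finset.sum_congr rfl fun k _ => ?_))
    · simp
    · simp [Xmat, D, Matrix.mul_apply, Fin.sum_univ_three, Matrix.transpose_apply,
        Matrix.diagonal_apply, Matrix.vecMul, dotProduct, F3x, F3z]
      ring
  rw [e]
  refine Finset.sum_induction _ GoodF (fun _ _ => GoodF.add) GoodF.zero fun k _ => ?_
  exact ((GoodF.mul_sq GoodP.one (ha k)).add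
    (GoodF.mul_sq (GoodP.X_sq 0 (by decide)) (hc k))).add
    (GoodF.mul_sq (GoodP.X_sq 2 (by decide)) (hb k))
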